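/- arXiv:2310.08201 — 4 statements merged into one kernel-verified Lean document; each statement's English description precedes it below -/
import Mathlib

section
/- Let g ≠ 0 and s₁ > 0 be real numbers, let θ₁ ∈ [0, π/2) (so cos θ₁ > 0), set R = −s₁/(g·cos θ₁), let z₁, z₂ be real numbers, set s₂ = s₁ + g·(z₂ − z₁), and let θ₂ be any real number. Then the circle condition z₁ + R·cos θ₁ = z₂ + R·cos θ₂ holds if and only if Snell's invariant s₁·cos θ₂ = s₂·cos θ₁ holds. -/
open Real

/-- Algebraic core of Property 2: for a linear sound speed profile
`s₂ = s₁ + g·(z₂ − z₁)` with gradient `g ≠ 0`, `s₁ > 0`, `θ₁ ∈ [0, π/2)` and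
`R = −s₁/(g·cos θ₁)`, the circle condition `z₁ + R·cos θ₁ = z₂ + R·cos θ₂`
holds iff Snell's invariant `s₁·cos θ₂ = s₂·cos θ₁` holds. -/
theorem circle_condition_iff_snell
    (g s₁ z₁ z₂ θ₁ θ₂ : ℝ) (hg : g ≠ 0) (hs₁ : 0 < s₁)
    (hθ₁ : θ₁ ∈ Set.Ico 0 (π / 2))
    (R : ℝ) (hR : R = -s₁ / (g * Real.cos θ₁))
    (s₂ : ℝ) (hs₂ : s₂ = s₁ + g * (z₂ - z₁)) :
    z₁ + R * Real.cos θ₁ = z₂ + R * Real.cos θ₂ ↔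
      s₁ * Real.cos θ₂ = s₂ * Real.cos θ₁ := by
  have hc : Real.cos θ₁ ≠ 0 :=
    (Real.cos_pos_of_mem_Ioo ⟨by linarith [hθ₁.1, Real.pi_pos], hθ₁.2⟩).ne'
  have hgc : g * Real.cos θ₁ ≠ 0 := mul_ne_zero hg hc
  have hRgc : R * (g * Real.cos θ₁) = -s₁ := by rw [hR, div_mul_cancel₀ _ hgc]
  subst hs₂
  constructor
  · intro h
    linear_combination (g * Real.cos θ₁) * h + (Real.cos θ₂ - Real.cos θ₁) * hRgc
  · intro h
    apply mul_left_cancel₀ hgc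
    linear_combination h - (Real.cos θ₂ - Real.cos θ₁) * hRgc
end

section
/- Let s₀ > 0 and θ₀ ∈ [0, π/2). Let s_{i−1}, s_i > 0 with s_i ≠ s_{i−1}, and let depths d_{i−1} < d_i. Define the layer gradient g_i = (s_i − s_{i−1})/(d_i − d_{i−1}) and τ_j = 1 − (s_j/s₀)²·cos² θ₀ for j ∈ {i−1, i}. Suppose θ_{i−1}, θ_i ∈ [0, π/2) satisfy Snell's invariant cos θ_{i−1} = (s_{i−1}/s₀)·cos θ₀ and cos θ_i = (s_i/s₀)·cos θ₀. Then (1/g_i)·ln( tan(θ_i/2 + π/4) / tan(θ_{i−1}/2 + π/4) ) = ((d_i − d_{i−1})/(s_i − s_{i−1}))·ln( (s_{i−1}/s_i)·(1 + √τ_i)/(1 + √τ_{i−1}) ). -/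
open Real

theorem tan_half_add_pi_div_four {x : ℝ} (hx : Real.cos x ≠ 0) :
    Real.tan (x / 2 + π / 4) = (1 + Real.sin x) / Real.cos x := by
  have hc : Real.cos x = (Real.cos (x / 2) - Real.sin (x / 2)) *
      (Real.cos (x / 2) + Real.sin (x / 2)) := by
    rw [← mul_div_cancel₀ x (two_ne_zero' ℝ), mul_div_assoc, Real.cos_two_mul']
    ring_nf
  have hs : 1 + Real.sin x = (Real.cos (x / 2) + Real.sin (x / 2)) ^ 2 := by
    have h := Real.sin_two_mul (x / 2)
    rw [mul_div_cancel₀ x two_ne_zero] at h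
    rw [h, ← Real.sin_sq_add_cos_sq (x / 2)]
    ring
  rw [hc] at hx
  have hm := left_ne_zero_of_mul hx
  have hp := right_ne_zero_of_mul hx
  rw [hs, hc, Real.tan_eq_sin_div_cos, Real.sin_add, Real.cos_add, Real.sin_pi_div_four,
    Real.cos_pi_div_four, ← add_mul, ← sub_mul, mul_div_mul_right _ _ (by positivity)]
  field_simp
  ring

theorem sqrt_one_sub_cos_sq {x : ℝ} (hx : x ∈ Set.Ico 0 (π / 2)) :
    √(1 - Real.cos x ^ 2) = Real.sin x := by
  rw [← Real.sin_sq, Real.sqrt_sq (Real.sin_nonneg_of_nonneg_of_le_pi hx.1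
    (by linarith [hx.2, Real.pi_pos]))]

/-- Per-layer travel-time identity (paper's eq. (8) rewritten as eq. (16)):
with layer gradient `gᵢ = (sᵢ − sᵢ₋₁)/(dᵢ − dᵢ₋₁)` and
`τⱼ = 1 − (sⱼ/s₀)²·cos² θ₀`, if the grazing angles satisfy Snell's invariant
`cos θⱼ = (sⱼ/s₀)·cos θ₀`, then
`(1/gᵢ)·ln(tan(θᵢ/2 + π/4)/tan(θᵢ₋₁/2 + π/4))
  = ((dᵢ − dᵢ₋₁)/(sᵢ − sᵢ₋₁))·ln((sᵢ₋₁/sᵢ)·(1 + √τᵢ)/(1 + √τᵢ₋₁))`.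
Here `sA, dA, θA` stand for the quantities indexed `i−1` and `sB, dB, θB`
for those indexed `i`. -/
theorem layer_time_identity
    (s₀ θ₀ sA sB dA dB θA θB : ℝ)
    (hs₀ : 0 < s₀) (hθ₀ : θ₀ ∈ Set.Ico 0 (π / 2))
    (hsA : 0 < sA) (hsB : 0 < sB) (hne : sB ≠ sA) (hd : dA < dB)
    (hθA : θA ∈ Set.Ico 0 (π / 2)) (hθB : θB ∈ Set.Ico 0 (π / 2))
    (hSnA : Real.cos θA = (sA / s₀) * Real.cos θ₀)
    (hSnB : Real.cos θB = (sB / s₀) * Real.cos θ₀) :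
    (1 / ((sB - sA) / (dB - dA))) *
        Real.log (Real.tan (θB / 2 + π / 4) / Real.tan (θA / 2 + π / 4))
      = ((dB - dA) / (sB - sA)) *
        Real.log ((sA / sB) *
          ((1 + Real.sqrt (1 - (sB / s₀) ^ 2 * Real.cos θ₀ ^ 2)) /
            (1 + Real.sqrt (1 - (sA / s₀) ^ 2 * Real.cos θ₀ ^ 2)))) := by
  have hcA : 0 < Real.cos θA := Real.cos_pos_of_mem_Ioo ⟨by linarith [hθA.1, pi_pos], hθA.2⟩
  have hcB : 0 < Real.cos θB := Real.cos_pos_of_mem_Ioo ⟨by linarith [hθB.1, pi_pos], hθB.2⟩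
  have hc₀ : 0 < Real.cos θ₀ := Real.cos_pos_of_mem_Ioo ⟨by linarith [hθ₀.1, pi_pos], hθ₀.2⟩
  have hsinA : 0 ≤ Real.sin θA :=
    Real.sin_nonneg_of_nonneg_of_le_pi hθA.1 (by linarith [hθA.2, pi_pos])
  rw [one_div_div, ← mul_pow, ← mul_pow, ← hSnA, ← hSnB, sqrt_one_sub_cos_sq hθA,
    sqrt_one_sub_cos_sq hθB, tan_half_add_pi_div_four hcA.ne', tan_half_add_pi_div_four hcB.ne',
    hSnA, hSnB]
  have hA : 1 + Real.sin θA ≠ 0 := by positivity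
  congr 2
  field_simp
end

section
/- Let depths d₀ < d₁ < … < d_I and sound speeds s₀, s₁, …, s_I > 0 satisfy s_i ≠ s_{i−1} for all i ∈ {1, …, I}. For θ₀ ∈ (0, π/2) with s_i·cos θ₀ < s₀ for all i, define τ_i(θ₀) = 1 − (s_i/s₀)²·cos² θ₀ and h(θ₀) = (s₀/cos θ₀)·Σ_{i=1}^{I} | ((d_i − d_{i−1})/(s_i − s_{i−1}))·(√τ_{i−1}(θ₀) − √τ_i(θ₀)) |. Then for all α, β in this domain with α > β, one has h(α) < h(β). -/
open Real

/-- The horizontal propagation distance of a non-reflected ray launched with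
initial grazing angle `θ₀` (paper's eq. (17)):
`h(θ₀) = (s₀/cos θ₀)·Σᵢ |((dᵢ − dᵢ₋₁)/(sᵢ − sᵢ₋₁))·(√τᵢ₋₁ − √τᵢ)|`
with `τᵢ = 1 − (sᵢ/s₀)²·cos² θ₀`. -/
noncomputable def rayHorizontalDistance (I : ℕ) (d s : ℕ → ℝ) (θ₀ : ℝ) : ℝ :=
  (s 0 / Real.cos θ₀) *
    ∑ i ∈ Finset.Icc 1 I,
      |((d i - d (i - 1)) / (s i - s (i - 1))) *
        (Real.sqrt (1 - (s (i - 1) / s 0) ^ 2 * Real.cos θ₀ ^ 2) -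
          Real.sqrt (1 - (s i / s 0) ^ 2 * Real.cos θ₀ ^ 2))| 

theorem one_sub_div_sq_mul_sq_pos {S x c : ℝ} (hS : 0 < S) (hx : 0 < x) (hc : 0 < c)
    (hxc : x * c < S) : 0 < 1 - (x / S) ^ 2 * c ^ 2 := by
  have hlt : x / S * c < 1 := by rwa [div_mul_eq_mul_div, div_lt_one hS]
  rw [← mul_pow, sub_pos]
  exact pow_lt_one₀ (by positivity) hlt two_ne_zero

/-- Rationalized form of the horizontal distance travelled across one linear-gradient layer of
thickness `Δ` with boundary speeds `A` and `B`, where `c` is the cosine of the launch angle. -/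
theorem layer_distance_eq {S A B Δ c : ℝ} (hS : 0 < S) (hA : 0 < A) (hB : 0 < B)
    (hAB : B ≠ A) (hΔ : 0 ≤ Δ) (hc : 0 < c) (hAc : A * c < S) (hBc : B * c < S) :
    S / c * |Δ / (B - A) * (√(1 - (A / S) ^ 2 * c ^ 2) - √(1 - (B / S) ^ 2 * c ^ 2))| =
      Δ * (A + B) / S * (c / (√(1 - (A / S) ^ 2 * c ^ 2) + √(1 - (B / S) ^ 2 * c ^ 2))) := by
  have hp := one_sub_div_sq_mul_sq_pos hS hA hc hAc
  have hq := one_sub_div_sq_mul_sq_pos hS hB hc hBc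
  have hp' := sqrt_pos.2 hp
  have hq' := sqrt_pos.2 hq
  have hp2 := sq_sqrt hp.le
  have hq2 := sq_sqrt hq.le
  generalize √(1 - (A / S) ^ 2 * c ^ 2) = p at *
  generalize √(1 - (B / S) ^ 2 * c ^ 2) = q at *
  have hsub : B - A ≠ 0 := sub_ne_zero.2 hAB
  have hpq : p + q ≠ 0 := by positivity
  have hdiff : (p - q) * (p + q) * S ^ 2 = (B - A) * (A + B) * c ^ 2 := by
    have hmul : (p - q) * (p + q) * S ^ 2 = (p ^ 2 - q ^ 2) * S ^ 2 := by ring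
    rw [hmul, hp2, hq2]
    field_simp
    ring
  have hinner : Δ / (B - A) * (p - q) = Δ * (A + B) * c ^ 2 / (S ^ 2 * (p + q)) := by
    rw [div_mul_eq_mul_div, div_eq_div_iff hsub (by positivity)]
    linear_combination Δ * hdiff
  rw [hinner, abs_of_nonneg (by positivity)]
  field_simp

/-- The horizontal distance travelled across one layer is strictly monotone in the cosine of the
launch angle. -/
theorem layer_distance_lt {S A B Δ c e : ℝ} (hS : 0 < S) (hA : 0 < A) (hB : 0 < B)
    (hAB : B ≠ A) (hΔ : 0 < Δ) (hc : 0 < c) (hce : c < e) (hAe : A * e < S) (hBe : B * e < S) :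
    S / c * |Δ / (B - A) * (√(1 - (A / S) ^ 2 * c ^ 2) - √(1 - (B / S) ^ 2 * c ^ 2))| <
      S / e * |Δ / (B - A) * (√(1 - (A / S) ^ 2 * e ^ 2) - √(1 - (B / S) ^ 2 * e ^ 2))| := by
  have he : 0 < e := hc.trans hce
  have hAc : A * c < S := (mul_lt_mul_of_pos_left hce hA).trans hAe
  have hBc : B * c < S := (mul_lt_mul_of_pos_left hce hB).trans hBe
  rw [layer_distance_eq hS hA hB hAB hΔ.le hc hAc hBc,
    layer_distance_eq hS hA hB hAB hΔ.le he hAe hBe]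
  refine mul_lt_mul_of_pos_left ?_ (by positivity)
  have hpos : 0 < √(1 - (A / S) ^ 2 * e ^ 2) :=
    sqrt_pos.2 (one_sub_div_sq_mul_sq_pos hS hA he hAe)
  refine div_lt_div₀ hce ?_ he.le (by positivity)
  gcongr

/-- Closed-form distance part of Corollary 1: `h` is strictly antitone in the
initial grazing angle on the set of angles `θ₀ ∈ (0, π/2)` satisfying the
non-turning condition `sᵢ·cos θ₀ < s₀` for all `i ≤ I`. -/
theorem rayHorizontalDistance_strict_anti
    (I : ℕ) (hI : 1 ≤ I) (d s : ℕ → ℝ)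
    (hd : ∀ i, 1 ≤ i → i ≤ I → d (i - 1) < d i)
    (hs : ∀ i ≤ I, 0 < s i)
    (hne : ∀ i, 1 ≤ i → i ≤ I → s i ≠ s (i - 1))
    (α β : ℝ) (hα : α ∈ Set.Ioo 0 (π / 2)) (hβ : β ∈ Set.Ioo 0 (π / 2))
    (hcutα : ∀ i ≤ I, s i * Real.cos α < s 0)
    (hcutβ : ∀ i ≤ I, s i * Real.cos β < s 0)
    (hαβ : β < α) :
    rayHorizontalDistance I d s α < rayHorizontalDistance I d s β := by
  have hcos : cos α < cos β := cos_lt_cos_of_nonneg_of_le_pi_div_two hβ.1.le hα.2.le hαβ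
  have hcosα : 0 < cos α := cos_pos_of_mem_Ioo ⟨by linarith [hα.1, pi_pos], hα.2⟩
  unfold rayHorizontalDistance
  rw [Finset.mul_sum, Finset.mul_sum]
  refine Finset.sum_lt_sum_of_nonempty (Finset.nonempty_Icc.2 hI) fun i hi => ?_
  obtain ⟨h1, hiI⟩ := Finset.mem_Icc.1 hi
  have hpred : i - 1 ≤ I := (Nat.sub_le i 1).trans hiI
  exact layer_distance_lt (hs 0 (Nat.zero_le I)) (hs _ hpred) (hs i hiI) (hne i h1 hiI)
    (sub_pos.2 (hd i h1 hiI)) hcosα hcos (hcutβ _ hpred) (hcutβ i hiI)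
end

section
/- Let depths d₀ < d₁ < … < d_I and sound speeds s₀, s₁, …, s_I > 0 satisfy s_i ≠ s_{i−1} for all i ∈ {1, …, I}. For θ₀ ∈ (0, π/2) with s_i·cos θ₀ < s₀ for all i, define τ_i(θ₀) = 1 − (s_i/s₀)²·cos² θ₀ and t(θ₀) = Σ_{i=1}^{I} | ((d_i − d_{i−1})/(s_i − s_{i−1}))·ln( (s_{i−1}·(1 + √τ_i(θ₀)))/(s_i·(1 + √τ_{i−1}(θ₀))) ) |. Then for all α, β in this domain with α > β, one has t(α) < t(β). -/
open Real

/-- The propagation time of a non-reflected ray launched with initial grazing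
angle `θ₀` (paper's eq. (16)):
`t(θ₀) = Σᵢ |((dᵢ − dᵢ₋₁)/(sᵢ − sᵢ₋₁))·ln((sᵢ₋₁·(1 + √τᵢ))/(sᵢ·(1 + √τᵢ₋₁)))|`
with `τᵢ = 1 − (sᵢ/s₀)²·cos² θ₀`. -/
noncomputable def rayTravelTime (I : ℕ) (d s : ℕ → ℝ) (θ₀ : ℝ) : ℝ :=
  ∑ i ∈ Finset.Icc 1 I,
    |((d i - d (i - 1)) / (s i - s (i - 1))) *
      Real.log
        ((s (i - 1) * (1 + Real.sqrt (1 - (s i / s 0) ^ 2 * Real.cos θ₀ ^ 2))) /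
          (s i * (1 + Real.sqrt (1 - (s (i - 1) / s 0) ^ 2 * Real.cos θ₀ ^ 2))))|

/-- The ratio `(1 + √(1 - c²q²)) / (1 + √(1 - c²p²))` strictly decreases in `c` when `p < q`,
in cross-multiplied form. -/
lemma one_add_sqrt_mul_lt {a b p q : ℝ} (ha : 0 < a) (hab : a < b) (hp : 0 < p) (hpq : p < q)
    (hbq : b * q < 1) :
    (1 + √(1 - a ^ 2 * p ^ 2)) * (1 + √(1 - b ^ 2 * q ^ 2)) <
      (1 + √(1 - a ^ 2 * q ^ 2)) * (1 + √(1 - b ^ 2 * p ^ 2)) := by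
  have hb : 0 < b := ha.trans hab
  have hq : 0 < q := hp.trans hpq
  have hab2 : a ^ 2 < b ^ 2 := by gcongr
  have hpq2 : p ^ 2 < q ^ 2 := by gcongr
  have hbq2 : b ^ 2 * q ^ 2 < 1 := by
    rw [← mul_pow]; exact pow_lt_one₀ (by positivity) hbq two_ne_zero
  have haq_bq : a ^ 2 * q ^ 2 < b ^ 2 * q ^ 2 := by gcongr
  have hbp_bq : b ^ 2 * p ^ 2 < b ^ 2 * q ^ 2 := by gcongr
  have hap_bp : a ^ 2 * p ^ 2 < b ^ 2 * p ^ 2 := by gcongr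
  have hx := Real.sq_sqrt (show 0 ≤ 1 - a ^ 2 * p ^ 2 by linarith)
  have hy := Real.sq_sqrt (show 0 ≤ 1 - a ^ 2 * q ^ 2 by linarith)
  have hu := Real.sq_sqrt (show 0 ≤ 1 - b ^ 2 * p ^ 2 by linarith)
  have hw := Real.sq_sqrt (show 0 ≤ 1 - b ^ 2 * q ^ 2 by linarith)
  have hw0 : 0 < √(1 - b ^ 2 * q ^ 2) := Real.sqrt_pos.2 (by linarith)
  have hxu : √(1 - b ^ 2 * p ^ 2) < √(1 - a ^ 2 * p ^ 2) :=
    Real.sqrt_lt_sqrt (by linarith) (by linarith)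
  have hyw : √(1 - b ^ 2 * q ^ 2) < √(1 - a ^ 2 * q ^ 2) :=
    Real.sqrt_lt_sqrt (by linarith) (by linarith)
  have huw : √(1 - b ^ 2 * q ^ 2) < √(1 - b ^ 2 * p ^ 2) :=
    Real.sqrt_lt_sqrt (by linarith) (by linarith)
  set x := √(1 - a ^ 2 * p ^ 2)
  set y := √(1 - a ^ 2 * q ^ 2)
  set u := √(1 - b ^ 2 * p ^ 2)
  set w := √(1 - b ^ 2 * q ^ 2)
  have hu0 : 0 < u := hw0.trans huw
  have hx0 : 0 < x := hu0.trans hxu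
  have hy0 : 0 < y := hw0.trans hyw
  have hxy : (x - y) / (1 + x) = a ^ 2 * (q ^ 2 - p ^ 2) / ((x + y) * (1 + x)) := by
    rw [div_eq_div_iff (by positivity) (by positivity)]
    linear_combination (1 + x) * (hx - hy)
  have huw' : (u - w) / (1 + u) = b ^ 2 * (q ^ 2 - p ^ 2) / ((u + w) * (1 + u)) := by
    rw [div_eq_div_iff (by positivity) (by positivity)]
    linear_combination (1 + u) * (hu - hw)
  have hd : 0 < q ^ 2 - p ^ 2 := sub_pos.2 hpq2
  have hlt : (x - y) / (1 + x) < (u - w) / (1 + u) := by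
    rw [hxy, huw']
    gcongr
  rw [div_lt_div_iff₀ (by positivity) (by positivity)] at hlt
  linarith

/-- The travel time through a layer with linear sound speed, as a function of `cos θ`, is
strictly increasing. -/
lemma abs_mul_log_layer_lt {c r a b p q : ℝ} (hc : c ≠ 0) (hr : 0 < r) (ha : 0 < a) (hb : 0 < b)
    (hab : a ≠ b) (hp : 0 < p) (hpq : p < q) (haq : a * q < r) (hbq : b * q < r) :
    |c * Real.log ((a * (1 + √(1 - (b / r) ^ 2 * p ^ 2))) /
        (b * (1 + √(1 - (a / r) ^ 2 * p ^ 2))))| <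
      |c * Real.log ((a * (1 + √(1 - (b / r) ^ 2 * q ^ 2))) /
        (b * (1 + √(1 - (a / r) ^ 2 * q ^ 2))))| := by
  rw [abs_mul, abs_mul]
  refine mul_lt_mul_of_pos_left ?_ (abs_pos.2 hc)
  wlog h : a < b generalizing a b
  · have := this hb ha hab.symm hbq haq (lt_of_le_of_ne (not_lt.1 h) hab.symm)
    rwa [← inv_div, Real.log_inv, abs_neg, ← inv_div (a * _), Real.log_inv, abs_neg] at this
  rw [← inv_div, Real.log_inv, abs_neg, ← inv_div (b * _), Real.log_inv, abs_neg]
  have hlt := one_add_sqrt_mul_lt (div_pos ha hr) (div_lt_div_of_pos_right h hr) hp hpq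
    (by rwa [div_mul_eq_mul_div, div_lt_one hr])
  have hle : √(1 - (b / r) ^ 2 * p ^ 2) ≤ √(1 - (a / r) ^ 2 * p ^ 2) := by gcongr
  have h1 : 1 < (b * (1 + √(1 - (a / r) ^ 2 * p ^ 2))) /
      (a * (1 + √(1 - (b / r) ^ 2 * p ^ 2))) := by
    rw [one_lt_div (by positivity)]
    exact mul_lt_mul h (by linarith) (by positivity) hb.le
  have h2 : (b * (1 + √(1 - (a / r) ^ 2 * p ^ 2))) / (a * (1 + √(1 - (b / r) ^ 2 * p ^ 2))) <
      (b * (1 + √(1 - (a / r) ^ 2 * q ^ 2))) / (a * (1 + √(1 - (b / r) ^ 2 * q ^ 2))) := by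
    rw [mul_div_mul_comm, mul_div_mul_comm]
    refine mul_lt_mul_of_pos_left ?_ (by positivity)
    rwa [div_lt_div_iff₀ (by positivity) (by positivity)]
  rw [abs_of_pos (Real.log_pos h1), abs_of_pos (Real.log_pos (h1.trans h2))]
  exact Real.log_lt_log (zero_lt_one.trans h1) h2

/-- Closed-form time part of Corollary 1: `t` is strictly antitone in the
initial grazing angle on the set of angles `θ₀ ∈ (0, π/2)` satisfying the
non-turning condition `sᵢ·cos θ₀ < s₀` for all `i ≤ I`. -/
theorem rayTravelTime_strict_anti
    (I : ℕ) (hI : 1 ≤ I) (d s : ℕ → ℝ)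
    (hd : ∀ i, 1 ≤ i → i ≤ I → d (i - 1) < d i)
    (hs : ∀ i ≤ I, 0 < s i)
    (hne : ∀ i, 1 ≤ i → i ≤ I → s i ≠ s (i - 1))
    (α β : ℝ) (hα : α ∈ Set.Ioo 0 (π / 2)) (hβ : β ∈ Set.Ioo 0 (π / 2))
    (hcutα : ∀ i ≤ I, s i * Real.cos α < s 0)
    (hcutβ : ∀ i ≤ I, s i * Real.cos β < s 0)
    (hαβ : β < α) :
    rayTravelTime I d s α < rayTravelTime I d s β := by
  have hcosα : 0 < Real.cos α :=
    Real.cos_pos_of_mem_Ioo ⟨by linarith [hα.1, Real.pi_pos], hα.2⟩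
  have hcos : Real.cos α < Real.cos β :=
    Real.cos_lt_cos_of_nonneg_of_le_pi_div_two hβ.1.le hα.2.le hαβ
  refine Finset.sum_lt_sum_of_nonempty (Finset.nonempty_Icc.2 hI) fun i hi => ?_
  obtain ⟨hi1, hiI⟩ := Finset.mem_Icc.1 hi
  have hi' : i - 1 ≤ I := by lia
  exact abs_mul_log_layer_lt
    (div_ne_zero (sub_pos.2 (hd i hi1 hiI)).ne' (sub_ne_zero.2 (hne i hi1 hiI)))
    (hs 0 I.zero_le) (hs _ hi') (hs i hiI) (hne i hi1 hiI).symm hcosα hcos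
    (hcutβ _ hi') (hcutβ i hiI)
end
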